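/- Let A, B ∈ H₂ with A < B, and let X ∈ H₂. Then there exists Y ∈ H₂ with rank(Y − A) ≤ 1, rank(Y − B) ≤ 1, and rank(X − Y) ≤ 1 if and only if at least one of the following holds: (o1) not (A < X and X < B), X ≤ B, and not X < A; (o2) not (A < X and X < B), A ≤ X, and not B < X. -/

import Mathlib

open Matrix
open scoped ComplexOrder

noncomputable section

/-- The space of `2×2` complex matrices. -/
abbrev Mat2 : Type := Matrix (Fin 2) (Fin 2) ℂ

/-- The group of `2×2` complex unitary matrices. -/
abbrev U2 : Type := Matrix.unitaryGroup (Fin 2) ℂ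

/-- Coherency for matrices: `A ∼ B` iff `rank (A − B) ≤ 1`. -/
def Coherent (A B : Mat2) : Prop := (A - B).rank ≤ 1

/-- Coherency for unitaries: `U ∼ V` iff `rank (U − V) ≤ 1`. -/
def CoherentU (U V : U2) : Prop := ((U : Mat2) - (V : Mat2)).rank ≤ 1

/-- The Cayley transform, as a matrix: `𝔠(A) = (A − iI)(A + iI)⁻¹`. -/
def cayleyMat (A : Mat2) : Mat2 :=
  (A - Complex.I • (1 : Mat2)) * (A + Complex.I • (1 : Mat2))⁻¹

open Classical in
/-- The Cayley transform, landing in the unitary group.  For every hermitian `A` the matrix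
`cayleyMat A` is unitary, so the junk value `1` is never used for the matrices considered here. -/
def cayley (A : Mat2) : U2 :=
  if h : cayleyMat A ∈ Matrix.unitaryGroup (Fin 2) ℂ then ⟨cayleyMat A, h⟩ else 1

/-- An automorphism of `U₂`: a bijection preserving coherency in both directions. -/
def IsAut (Φ : U2 → U2) : Prop :=
  Function.Bijective Φ ∧ ∀ U V : U2, CoherentU U V ↔ CoherentU (Φ U) (Φ V)

/-- A line in `U₂`: a maximal subset all of whose elements are pairwise coherent. -/
def IsLine (ℓ : Set U2) : Prop :=
  (∀ U ∈ ℓ, ∀ V ∈ ℓ, CoherentU U V) ∧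
  ∀ m : Set U2, ℓ ⊆ m → (∀ U ∈ m, ∀ V ∈ m, CoherentU U V) → m = ℓ

/-- The matrix interval `[A, B] = {X : A ≤ X ≤ B}` (in the Loewner order). -/
def matIcc (A B : Mat2) : Set Mat2 := {X | (X - A).PosSemidef ∧ (B - X).PosSemidef}

/-- Rank one projections: `P = P* = P²` of rank one. -/
def IsProj1 (P : Mat2) : Prop := P.IsHermitian ∧ P * P = P ∧ P.rank = 1

/-- The hermitian matrix with Minkowski coordinates `(t, x, y, z)`. -/
def minkowskiMat (t x y z : ℝ) : Mat2 :=
  !![(t + z : ℂ), x - y * Complex.I; x + y * Complex.I, t - z]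

theorem isHermitian_minkowskiMat (t x y z : ℝ) : (minkowskiMat t x y z).IsHermitian := by
  ext i j
  fin_cases i <;> fin_cases j <;> simp [minkowskiMat, sub_eq_add_neg]

theorem exists_eq_minkowskiMat {M : Mat2} (hM : M.IsHermitian) :
    ∃ t x y z : ℝ, M = minkowskiMat t x y z := by
  refine ⟨((M 0 0).re + (M 1 1).re) / 2, (M 1 0).re, (M 1 0).im,
    ((M 0 0).re - (M 1 1).re) / 2, ?_⟩
  have h00 := hM.apply 0 0
  have h11 := hM.apply 1 1
  have h01 := hM.apply 0 1
  simp only [Complex.ext_iff, Complex.star_def, Complex.conj_re, Complex.conj_im] at h00 h11 h01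
  ext i j
  fin_cases i <;> fin_cases j <;> simp [minkowskiMat, Complex.ext_iff] <;>
    constructor <;> linarith [h00.2, h11.2, h01.1, h01.2]

theorem one_eq_minkowskiMat : (1 : Mat2) = minkowskiMat 1 0 0 0 := by
  ext i j
  fin_cases i <;> fin_cases j <;> simp [minkowskiMat]

theorem minkowskiMat_sub (t x y z t' x' y' z' : ℝ) :
    minkowskiMat t x y z - minkowskiMat t' x' y' z' =
      minkowskiMat (t - t') (x - x') (y - y') (z - z') := by
  ext i j
  fin_cases i <;> fin_cases j <;> simp [minkowskiMat] <;> ring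

theorem neg_minkowskiMat (t x y z : ℝ) :
    -minkowskiMat t x y z = minkowskiMat (-t) (-x) (-y) (-z) := by
  ext i j
  fin_cases i <;> fin_cases j <;> simp [minkowskiMat] <;> ring

theorem det_minkowskiMat (t x y z : ℝ) :
    (minkowskiMat t x y z).det = ((t ^ 2 - (x ^ 2 + y ^ 2 + z ^ 2) : ℝ) : ℂ) := by
  simp only [minkowskiMat, det_fin_two_of]
  push_cast
  linear_combination (y : ℂ) ^ 2 * Complex.I_sq

theorem trace_minkowskiMat (t x y z : ℝ) :
    (minkowskiMat t x y z).trace = ((2 * t : ℝ) : ℂ) := by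
  simp only [minkowskiMat, trace_fin_two_of]
  push_cast
  ring

theorem posSemidef_minkowskiMat_iff (t x y z : ℝ) :
    (minkowskiMat t x y z).PosSemidef ↔ √(x ^ 2 + y ^ 2 + z ^ 2) ≤ t := by
  have hn : 0 ≤ x ^ 2 + y ^ 2 + z ^ 2 := by positivity
  constructor
  · intro h
    have hd := h.det_nonneg
    have ht := h.trace_nonneg
    rw [det_minkowskiMat, Complex.zero_le_real] at hd
    rw [trace_minkowskiMat, Complex.zero_le_real] at ht
    exact Real.sqrt_le_iff.2 ⟨by linarith, by linarith⟩
  · intro h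
    set r := √(x ^ 2 + y ^ 2 + z ^ 2)
    have hr2 : r ^ 2 = x ^ 2 + y ^ 2 + z ^ 2 := Real.sq_sqrt hn
    have hr2' : (r : ℂ) ^ 2 = x ^ 2 + y ^ 2 + z ^ 2 := by exact_mod_cast hr2
    have hr0 : 0 ≤ r := Real.sqrt_nonneg _
    have hone : ((t - r) • (1 : Mat2)).PosSemidef :=
      PosSemidef.one.smul (sub_nonneg.2 h)
    rcases hr0.eq_or_lt with h0 | h0
    · have hx : x = 0 := by nlinarith [sq_nonneg x, sq_nonneg y, sq_nonneg z]
      have hy : y = 0 := by nlinarith [sq_nonneg x, sq_nonneg y, sq_nonneg z]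
      have hz : z = 0 := by nlinarith [sq_nonneg x, sq_nonneg y, sq_nonneg z]
      convert hone using 1
      rw [← h0, hx, hy, hz]
      ext i j
      fin_cases i <;> fin_cases j <;> simp [minkowskiMat]
    · have hsq := (posSemidef_conjTranspose_mul_self (minkowskiMat r x y z)).smul
        (inv_nonneg.2 (by positivity : 0 ≤ 2 * r))
      rw [(isHermitian_minkowskiMat r x y z).eq] at hsq
      convert hone.add hsq using 1
      have hrc : (r : ℂ) ≠ 0 := by exact_mod_cast h0.ne'
      ext i j
      fin_cases i <;> fin_cases j <;>
        simp [minkowskiMat] <;> field_simp <;> ring_nf <;>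
        simp only [Complex.I_sq, hr2'] <;> ring

theorem posDef_minkowskiMat_iff (t x y z : ℝ) :
    (minkowskiMat t x y z).PosDef ↔ √(x ^ 2 + y ^ 2 + z ^ 2) < t := by
  have hn : 0 ≤ x ^ 2 + y ^ 2 + z ^ 2 := by positivity
  have hs := Real.sq_sqrt hn
  have hs0 := Real.sqrt_nonneg (x ^ 2 + y ^ 2 + z ^ 2)
  constructor
  · intro h
    have hd := h.det_pos
    rw [det_minkowskiMat, Complex.zero_lt_real] at hd
    have hle := (posSemidef_minkowskiMat_iff t x y z).1 h.posSemidef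
    nlinarith
  · intro h
    rw [((posSemidef_minkowskiMat_iff t x y z).2 h.le).posDef_iff_det_ne_zero, det_minkowskiMat,
      Complex.ofReal_ne_zero]
    nlinarith

theorem rank_le_one_iff_det_eq_zero (M : Mat2) : M.rank ≤ 1 ↔ M.det = 0 := by
  constructor
  · intro h
    by_contra hd
    have := rank_of_det_ne_zero hd
    simp at this
    omega
  · intro h
    by_contra hr
    have h2 : Fintype.card (Fin 2) = Set.finrank ℂ (Set.range M.col) := by
      have hle := M.rank_le_width
      rw [Set.finrank, ← rank_eq_finrank_span_cols, Fintype.card_fin]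
      omega
    have hu := linearIndependent_cols_iff_isUnit.1
      (linearIndependent_iff_card_eq_finrank_span.2 h2)
    exact ((isUnit_iff_isUnit_det M).1 hu).ne_zero h

theorem rank_minkowskiMat_le_one_iff (t x y z : ℝ) :
    (minkowskiMat t x y z).rank ≤ 1 ↔ t ^ 2 = x ^ 2 + y ^ 2 + z ^ 2 := by
  rw [rank_le_one_iff_det_eq_zero, det_minkowskiMat, Complex.ofReal_eq_zero, sub_eq_zero]

theorem exists_unit_orthogonal (x y z : ℝ) :
    ∃ a b c : ℝ, a ^ 2 + b ^ 2 + c ^ 2 = 1 ∧ x * a + y * b + z * c = 0 := by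
  by_cases h : x ^ 2 + y ^ 2 = 0
  · have hx : x = 0 := by nlinarith [sq_nonneg x, sq_nonneg y]
    exact ⟨1, 0, 0, by norm_num, by rw [hx]; ring⟩
  · have hn : 0 ≤ x ^ 2 + y ^ 2 := by positivity
    have hs : √(x ^ 2 + y ^ 2) ^ 2 = x ^ 2 + y ^ 2 := Real.sq_sqrt hn
    have hs0 : √(x ^ 2 + y ^ 2) ≠ 0 := Real.sqrt_ne_zero'.2 (hn.lt_of_ne' h)
    refine ⟨-y / √(x ^ 2 + y ^ 2), x / √(x ^ 2 + y ^ 2), 0, ?_, by ring⟩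
    field_simp
    rw [hs]
    ring

theorem exists_sphere_inner_eq {x y z r p : ℝ} (hr : r ^ 2 = x ^ 2 + y ^ 2 + z ^ 2)
    (hp : (2 * p) ^ 2 ≤ r ^ 2) :
    ∃ a b c : ℝ, a ^ 2 + b ^ 2 + c ^ 2 = 1 / 4 ∧ x * a + y * b + z * c = p := by
  obtain ⟨a, b, c, hn, ho⟩ := exists_unit_orthogonal x y z
  by_cases h0 : r = 0
  · refine ⟨a / 2, b / 2, c / 2, by linarith, ?_⟩
    have : p = 0 := by
      rw [h0] at hp
      nlinarith [sq_nonneg p]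
    linarith
  · have hr0 : 0 < r ^ 2 := by positivity
    have hk : 0 ≤ 1 / 4 - p ^ 2 / r ^ 2 := by
      rw [sub_nonneg, div_le_iff₀ hr0]
      linarith
    have hk2 := Real.sq_sqrt hk
    set k := √(1 / 4 - p ^ 2 / r ^ 2)
    have hq : p / r ^ 2 * r ^ 2 = p := div_mul_cancel₀ _ hr0.ne'
    have hq2 : p ^ 2 / r ^ 2 = p / r ^ 2 * p := by ring
    set q := p / r ^ 2
    refine ⟨q * x + k * a, q * y + k * b, q * z + k * c, ?_, ?_⟩
    · linear_combination k ^ 2 * hn + 2 * q * k * ho + hk2 - q ^ 2 * hr + q * hq - hq2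
    · linear_combination k * ho - q * hr + hq

/-- The light cone of `(t, x, y, z)` meets the intersection of the light cones of the origin and of
`(1, 0, 0, 0)` iff two quadratic inequalities in `t` and the spatial radius `r` hold. -/
theorem exists_lightlike_iff {t x y z r : ℝ} (hr : r ^ 2 = x ^ 2 + y ^ 2 + z ^ 2) (hr0 : 0 ≤ r) :
    (∃ s a b c : ℝ, s ^ 2 = a ^ 2 + b ^ 2 + c ^ 2 ∧ (s - 1) ^ 2 = a ^ 2 + b ^ 2 + c ^ 2 ∧
      (t - s) ^ 2 = (x - a) ^ 2 + (y - b) ^ 2 + (z - c) ^ 2) ↔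
    0 ≤ (t - r) * (t + r - 1) ∧ (t + r) * (t - r - 1) ≤ 0 := by
  constructor
  · rintro ⟨s, a, b, c, h1, h2, h3⟩
    obtain rfl : s = 1 / 2 := by linarith
    have hp : (2 * (x * a + y * b + z * c)) ^ 2 ≤ r ^ 2 := by
      nlinarith [sq_nonneg (x * b - y * a), sq_nonneg (x * c - z * a), sq_nonneg (y * c - z * b)]
    obtain ⟨hl, hu⟩ := abs_le.1 (abs_le_of_sq_le_sq hp hr0)
    constructor <;> nlinarith
  · rintro ⟨h1, h2⟩
    obtain ⟨a, b, c, hn, hi⟩ := exists_sphere_inner_eq (p := (r ^ 2 + t - t ^ 2) / 2) hr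
      (sq_le_sq' (by linarith) (by linarith))
    exact ⟨1 / 2, a, b, c, by linarith, by linarith, by linarith⟩

theorem lightlike_inequalities_iff {t r : ℝ} (hr0 : 0 ≤ r) :
    (0 ≤ (t - r) * (t + r - 1) ∧ (t + r) * (t - r - 1) ≤ 0) ↔
      (¬(r < t ∧ r < 1 - t) ∧ r ≤ 1 - t ∧ ¬r < -t) ∨
      (¬(r < t ∧ r < 1 - t) ∧ r ≤ t ∧ ¬r < t - 1) := by
  simp only [not_and, not_lt]
  constructor
  · rintro ⟨h1, h2⟩
    have hl : -t ≤ r := by nlinarith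
    have hu : t - 1 ≤ r := by nlinarith
    rcases mul_nonneg_iff.1 h1 with ⟨h, h'⟩ | ⟨h, h'⟩
    · exact Or.inr ⟨fun _ => by linarith, by linarith, hu⟩
    · exact Or.inl ⟨fun _ => by linarith, by linarith, hl⟩
  · rintro (⟨h1, h2, h3⟩ | ⟨h1, h2, h3⟩)
    · refine ⟨?_, mul_nonpos_of_nonneg_of_nonpos (by linarith) (by linarith)⟩
      rcases lt_or_ge r t with h | h
      · exact mul_nonneg (by linarith) (by linarith [h1 h])
      · exact mul_nonneg_of_nonpos_of_nonpos (by linarith) (by linarith)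
    · refine ⟨?_, mul_nonpos_of_nonneg_of_nonpos (by linarith) (by linarith)⟩
      rcases h2.lt_or_eq with h | h
      · exact mul_nonneg (by linarith) (by linarith [h1 h])
      · simp [h]

/-- The case `A = 0`, `B = 1`. -/
theorem coherent_to_S_zero_one_iff (X : Mat2) (hX : X.IsHermitian) :
    (∃ Y : Mat2, Y.IsHermitian ∧ Y.rank ≤ 1 ∧ (Y - 1).rank ≤ 1 ∧ (X - Y).rank ≤ 1) ↔
      ((¬ (X.PosDef ∧ (1 - X).PosDef)) ∧ (1 - X).PosSemidef ∧ ¬ (-X).PosDef) ∨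
      ((¬ (X.PosDef ∧ (1 - X).PosDef)) ∧ X.PosSemidef ∧ ¬ (X - 1).PosDef) := by
  obtain ⟨t, x, y, z, rfl⟩ := exists_eq_minkowskiMat hX
  have hn : 0 ≤ x ^ 2 + y ^ 2 + z ^ 2 := by positivity
  rw [one_eq_minkowskiMat]
  simp only [minkowskiMat_sub, neg_minkowskiMat, posDef_minkowskiMat_iff,
    posSemidef_minkowskiMat_iff, sub_zero, zero_sub, neg_sq]
  rw [← lightlike_inequalities_iff (Real.sqrt_nonneg _),
    ← exists_lightlike_iff (Real.sq_sqrt hn) (Real.sqrt_nonneg _)]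
  constructor
  · rintro ⟨Y, hY, h1, h2, h3⟩
    obtain ⟨s, a, b, c, rfl⟩ := exists_eq_minkowskiMat hY
    simp only [minkowskiMat_sub, rank_minkowskiMat_le_one_iff, sub_zero] at h1 h2 h3
    exact ⟨s, a, b, c, h1, h2, h3⟩
  · rintro ⟨s, a, b, c, h1, h2, h3⟩
    refine ⟨minkowskiMat s a b c, isHermitian_minkowskiMat s a b c, ?_⟩
    simp only [minkowskiMat_sub, rank_minkowskiMat_le_one_iff, sub_zero]
    exact ⟨h1, h2, h3⟩

open scoped MatrixOrder Matrix.Norms.L2Operator in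
theorem exists_isUnit_eq_star_mul_self {D : Mat2} (hD : D.PosDef) :
    ∃ C : Mat2, IsUnit C ∧ D = star C * C := by
  obtain ⟨C, rfl⟩ := CStarAlgebra.nonneg_iff_eq_star_mul_self.mp hD.posSemidef.nonneg
  exact ⟨C, (IsUnit.mul_iff.1 hD.isUnit).2, rfl⟩

theorem rank_star_conjugate {C : Mat2} (hC : IsUnit C) (M : Mat2) :
    (star C * M * C).rank = M.rank := by
  rw [rank_mul_eq_left_of_isUnit_det _ _ ((isUnit_iff_isUnit_det _).1 hC),
    rank_mul_eq_right_of_isUnit_det _ _ ((isUnit_iff_isUnit_det _).1 hC.star)]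

theorem exists_hermitian_star_conjugate {C : Mat2} (hC : IsUnit C) {M : Mat2}
    (hM : M.IsHermitian) : ∃ N : Mat2, N.IsHermitian ∧ M = star C * N * C := by
  lift C to Mat2ˣ using hC
  refine ⟨star (↑C⁻¹ : Mat2) * M * (↑C⁻¹ : Mat2), isHermitian_conjTranspose_mul_mul _ hM, ?_⟩
  have h : star (C : Mat2) * star (↑C⁻¹ : Mat2) = 1 := by
    rw [← star_mul, Units.inv_mul, star_one]
  calc M = star (C : Mat2) * star (↑C⁻¹ : Mat2) * M * ((↑C⁻¹ : Mat2) * C) := by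
        rw [h, C.inv_mul, one_mul, mul_one]
    _ = _ := by simp only [mul_assoc]

/-- For `A < B`, a hermitian `X` is coherent to some element of `𝒮_{A,B}` iff condition (o1) or
(o2) holds. -/
theorem coherent_to_S_AB_iff
    (A B : Mat2) (hA : A.IsHermitian) (hB : B.IsHermitian) (hAB : (B - A).PosDef)
    (X : Mat2) (hX : X.IsHermitian) :
    (∃ Y : Mat2, Y.IsHermitian ∧ (Y - A).rank ≤ 1 ∧ (Y - B).rank ≤ 1 ∧
        (X - Y).rank ≤ 1) ↔
      ((¬ ((X - A).PosDef ∧ (B - X).PosDef)) ∧ (B - X).PosSemidef ∧ ¬ (A - X).PosDef) ∨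
      ((¬ ((X - A).PosDef ∧ (B - X).PosDef)) ∧ (X - A).PosSemidef ∧ ¬ (X - B).PosDef) := by
  obtain ⟨C, hC, hBA⟩ := exists_isUnit_eq_star_mul_self hAB
  obtain ⟨Z, hZ, hXZ⟩ := exists_hermitian_star_conjugate hC (hX.sub hA)
  have hB' : B = A + star C * C := by rw [← hBA]; abel
  have hX' : X = A + star C * Z * C := by rw [← hXZ]; abel
  have hBX : B - X = star C * (1 - Z) * C := by rw [hB', hX']; noncomm_ring
  have hXB : X - B = star C * (Z - 1) * C := by rw [hB', hX']; noncomm_ring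
  have hAX : A - X = star C * (-Z) * C := by rw [hX']; noncomm_ring
  rw [hXZ, hBX, hXB, hAX]
  simp only [IsUnit.posDef_star_left_conjugate_iff hC, IsUnit.posSemidef_star_left_conjugate_iff hC]
  rw [← coherent_to_S_zero_one_iff Z hZ]
  constructor
  · rintro ⟨Y, hY, h1, h2, h3⟩
    obtain ⟨W, hW, hYW⟩ := exists_hermitian_star_conjugate hC (hY.sub hA)
    have hY' : Y = A + star C * W * C := by rw [← hYW]; abel
    have hYB : Y - B = star C * (W - 1) * C := by rw [hB', hY']; noncomm_ring
    have hXY : X - Y = star C * (Z - W) * C := by rw [hX', hY']; noncomm_ring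
    rw [hYW, rank_star_conjugate hC] at h1
    rw [hYB, rank_star_conjugate hC] at h2
    rw [hXY, rank_star_conjugate hC] at h3
    exact ⟨W, hW, h1, h2, h3⟩
  · rintro ⟨W, hW, h1, h2, h3⟩
    have hYB : A + star C * W * C - B = star C * (W - 1) * C := by rw [hB']; noncomm_ring
    have hXY : X - (A + star C * W * C) = star C * (Z - W) * C := by rw [hX']; noncomm_ring
    refine ⟨A + star C * W * C, hA.add (isHermitian_conjTranspose_mul_mul _ hW), ?_, ?_, ?_⟩
    · rwa [add_sub_cancel_left, rank_star_conjugate hC]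
    · rwa [hYB, rank_star_conjugate hC]
    · rwa [hXY, rank_star_conjugate hC]
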